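/- arXiv:1312.2206 — 2 statements merged into one kernel-verified Lean document; each statement's English description precedes it below -/
import Mathlib

section
/- (Theorem 1, part 1 — optimality.) Fix b ∈ (√(2/e), √2) and set k = K(b) = -(e-1)b(b²e - 2)/(2 + (e-2)b²e), a = (b²e - 2)/((e-1)b), q(b) = (1/2)[b² - k² + k(b - a) - k² log(b/a)], and J_min(b) = √2 (k log(b/a) + b + k). Then every admissible function λ : [0,1] → ℝ (i.e. λ(0) = 0, λ'(σ) ≥ 0, λ(σ)λ'(σ) ≤ 1) with I[λ] = q(b) satisfies J[λ] ≥ J_min(b). -/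
open MeasureTheory Real

/-- The functional `I[λ] = -∫₀¹ λλ' log(λλ') dσ`. -/
noncomputable def lamLift (lam : ℝ → ℝ) : ℝ :=
  -∫ σ in (0:ℝ)..1, lam σ * deriv lam σ * Real.log (lam σ * deriv lam σ)

/-- The functional `J[λ] = -√2 ∫₀¹ λ' log(λλ') dσ`. -/
noncomputable def lamDrag (lam : ℝ → ℝ) : ℝ :=
  -Real.sqrt 2 * ∫ σ in (0:ℝ)..1, deriv lam σ * Real.log (lam σ * deriv lam σ)


/-- value of the dual function -/
noncomputable def dualD (κ x : ℝ) : ℝ :=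
  x / 2 - κ / 2 - (κ / 2) * Real.log (((Real.exp 1 - 1) * x + κ) / (Real.exp 1 * κ))
    - (1 - κ / x) / (κ * Real.exp 1)

lemma dualD_self (κ : ℝ) (hκ : 0 < κ) : dualD κ κ = 0 := by
  unfold dualD
  have h : ((Real.exp 1 - 1) * κ + κ) / (Real.exp 1 * κ) = 1 := by
    have := Real.exp_pos 1
    field_simp
    ring
  rw [h, Real.log_one, div_self hκ.ne']
  ring

lemma dualD_ge (κ b x : ℝ) (hκ : 0 < κ) (hb : 0 < b) (hx : 0 < x)
    (hT : Real.exp 1 * b ^ 2 * ((Real.exp 1 - 1) * b + κ - (Real.exp 1 - 1) * κ)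
      = 2 * ((Real.exp 1 - 1) * b + κ)) : dualD κ b ≤ dualD κ x := by
  unfold dualD
  have hE : 1 < Real.exp 1 := by simp
  set E := Real.exp 1
  have hE0 : 0 < E := by linarith
  have hu : 0 < (E - 1) * x + κ := by nlinarith [mul_pos (sub_pos.2 hE) hx]
  have hv : 0 < (E - 1) * b + κ := by nlinarith [mul_pos (sub_pos.2 hE) hb]
  have hl : Real.log (((E - 1) * x + κ) / (E * κ)) - Real.log (((E - 1) * b + κ) / (E * κ))
      ≤ ((E - 1) * x + κ) / ((E - 1) * b + κ) - 1 := by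
    rw [← Real.log_div (by positivity) (by positivity)]
    have : ((E - 1) * x + κ) / (E * κ) / (((E - 1) * b + κ) / (E * κ))
        = ((E - 1) * x + κ) / ((E - 1) * b + κ) := by field_simp
    rw [this]
    exact Real.log_le_sub_one_of_pos (by positivity)
  have key : x / 2 - b / 2 - κ / 2 * (((E - 1) * x + κ) / ((E - 1) * b + κ) - 1)
      - (1 - κ / x) / (κ * E) + (1 - κ / b) / (κ * E) = (x - b) ^ 2 / (E * b ^ 2 * x) := by
    have hv' : b * (E - 1) + κ ≠ 0 := by nlinarith [hv]
    field_simp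
    linear_combination (κ * x * (x - b)) * hT
  have h2 : 0 ≤ (x - b) ^ 2 / (E * b ^ 2 * x) := by positivity
  nlinarith [mul_le_mul_of_nonneg_left hl (by positivity : 0 ≤ κ / 2)]

/-- algebra of the parameters -/
lemma params (b : ℝ) (hb : b ∈ Set.Ioo (Real.sqrt (2 / Real.exp 1)) (Real.sqrt 2))
    (k a q Jmin : ℝ)
    (hk : k = -((Real.exp 1 - 1) * b * (b ^ 2 * Real.exp 1 - 2)) /
      (2 + (Real.exp 1 - 2) * b ^ 2 * Real.exp 1))
    (ha : a = (b ^ 2 * Real.exp 1 - 2) / ((Real.exp 1 - 1) * b))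
    (hq : q = (1 / 2) * (b ^ 2 - k ^ 2 + k * (b - a) - k ^ 2 * Real.log (b / a)))
    (hJmin : Jmin = Real.sqrt 2 * (k * Real.log (b / a) + b + k)) :
    0 < b ∧ k < 0 ∧ 
    Real.exp 1 * b ^ 2 * ((Real.exp 1 - 1) * b + (-k) - (Real.exp 1 - 1) * (-k))
      = 2 * ((Real.exp 1 - 1) * b + (-k)) ∧ 
    Jmin = Real.sqrt 2 * (dualD (-k) b + q / (-k)) := by
  obtain ⟨h1, h2⟩ := hb
  have hE : 2 < Real.exp 1 := by linarith [Real.exp_one_gt_d9]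
  have hb0 : 0 < b := lt_of_le_of_lt (Real.sqrt_nonneg _) h1
  have hb2 : 2 / Real.exp 1 < b ^ 2 := (Real.sqrt_lt' hb0).1 h1
  unfold dualD
  set E := Real.exp 1
  have hn : 0 < b ^ 2 * E - 2 := by
    rw [div_lt_iff₀ (by linarith)] at hb2; linarith
  have hE1 : 0 < E - 1 := by linarith
  have hE2 : 0 < E - 2 := by linarith
  have hE0 : 0 < E := by linarith
  have hd : 0 < 2 + (E - 2) * b ^ 2 * E := by positivity
  have hkm : k * (2 + (E - 2) * b ^ 2 * E) = -((E - 1) * b * (b ^ 2 * E - 2)) := by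
    rw [hk]; field_simp
  have hk0 : k < 0 := by
    rw [hk, neg_div]; have : 0 < (E - 1) * b * (b ^ 2 * E - 2) / (2 + (E - 2) * b ^ 2 * E) := by positivity
    linarith
  have ha0 : 0 < a := by rw [ha]; positivity
  have ham : a * ((E - 1) * b) = b ^ 2 * E - 2 := by rw [ha]; field_simp
  refine ⟨hb0, hk0, by linear_combination hkm, ?_⟩
  have hr : ((E - 1) * b + -k) / (E * -k) = b / a := by
    rw [div_eq_div_iff (by nlinarith) ha0.ne']
    have : (E - 1) * b ≠ 0 := by positivity
    apply mul_left_cancel₀ this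
    linear_combination ((E - 1) * b - k) * ham + hkm
  rw [hr, hJmin, hq]
  congr 1
  have hk' : k ≠ 0 := hk0.ne
  have hX : b + b^2/(2*k) - a/2 = 1/(k*E) + 1/(E*b) := by
    rw [ha]
    field_simp
    linear_combination hkm
  have : (1 - -k / b) / (-k * E) = -(1/(k*E) + 1/(E*b)) := by
    field_simp
    ring
  rw [this, ← hX]
  field_simp
  ring

noncomputable def rr (κ A x : ℝ) : ℝ := max 1 (A * (x - κ) / max x κ)

noncomputable def mm (κ A x : ℝ) : ℝ :=
  Real.log (rr κ A x) * (1 - x / κ) + x * rr κ A x / (κ * A)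

lemma rr_cont (κ A : ℝ) (hκ : 0 < κ) : Continuous (rr κ A) := by
  unfold rr
  refine continuous_const.max (Continuous.div (by fun_prop) (by fun_prop) ?_)
  intro x
  exact (lt_of_lt_of_le hκ (le_max_right _ _)).ne'

lemma rr_ge (κ A x : ℝ) : 1 ≤ rr κ A x := le_max_left _ _

lemma mm_cont (κ A : ℝ) (hκ : 0 < κ) : Continuous (mm κ A) := by
  unfold mm
  have h := rr_cont κ A hκ
  have h2 : Continuous fun x => Real.log (rr κ A x) :=
    h.log (fun x => by have := rr_ge κ A x; positivity)
  fun_prop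

lemma mm_opt (κ A x ρ : ℝ) (hκ : 0 < κ) (hA : 0 < A) (hx : 0 < x) (hρ : 1 ≤ ρ) :
    mm κ A x ≤ Real.log ρ * (1 - x / κ) + x * ρ / (κ * A) := by
  have hr := rr_ge κ A x
  unfold mm
  rcases le_total x κ with h | h
  · have : rr κ A x = 1 := by
      unfold rr
      apply max_eq_left
      have : A * (x - κ) / max x κ ≤ 0 := by
        apply div_nonpos_of_nonpos_of_nonneg
        · nlinarith
        · positivity
      linarith
    rw [this, Real.log_one, zero_mul, zero_add]
    have h1 : 0 ≤ Real.log ρ * (1 - x / κ) := by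
      apply mul_nonneg (Real.log_nonneg hρ)
      rw [sub_nonneg, div_le_one hκ]; exact h
    have h2 : x * 1 / (κ * A) ≤ x * ρ / (κ * A) := by gcongr
    linarith
  · have hr0 : 0 < rr κ A x := by linarith
    have hρ0 : 0 < ρ := by linarith
    have hl : Real.log ρ - Real.log (rr κ A x) ≤ ρ / rr κ A x - 1 := by
      rw [← Real.log_div hρ0.ne' hr0.ne']
      exact Real.log_le_sub_one_of_pos (by positivity)
    have hc : 0 ≤ x / κ - 1 := by rw [sub_nonneg, one_le_div hκ]; exact h
    have hm := mul_le_mul_of_nonneg_left hl hc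
    have key : 0 ≤ x * ρ / (κ * A) - x * rr κ A x / (κ * A)
        - (x / κ - 1) * (ρ / rr κ A x - 1) := by
      have e : x * ρ / (κ * A) - x * rr κ A x / (κ * A)
        - (x / κ - 1) * (ρ / rr κ A x - 1)
        = (ρ - rr κ A x) * (x * rr κ A x - A * (x - κ)) / (κ * A * rr κ A x) := by
        field_simp
      rw [e]
      apply div_nonneg _ (by positivity)
      have hmx : rr κ A x = max 1 (A * (x - κ) / x) := by unfold rr; rw [max_eq_left h]
      rcases le_total 1 (A * (x - κ) / x) with h1 | h1
      · rw [max_eq_right h1] at hmx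
        have : x * rr κ A x - A * (x - κ) = 0 := by rw [hmx]; field_simp; ring
        rw [this, mul_zero]
      · rw [max_eq_left h1] at hmx
        rw [hmx]
        rw [div_le_one hx] at h1
        apply mul_nonneg <;> linarith
    nlinarith

lemma pw (κ A x d : ℝ) (hκ : 0 < κ) (hA : 0 < A) (hx : 0 < x) (hd : 0 ≤ d) (hp : x * d ≤ 1) :
    mm κ A x * d - 1 / (κ * A) ≤
      -(d * Real.log (x * d)) + 1 / κ * (x * d * Real.log (x * d)) := by
  rcases hd.eq_or_lt with h | h
  · subst h
    simp
    positivity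
  · have hxd : 0 < x * d := by positivity
    have := mm_opt κ A x (1 / (x * d)) hκ hA hx (by rw [le_div_iff₀ hxd]; linarith)
    have h2 := mul_le_mul_of_nonneg_right this hd
    rw [Real.log_div one_ne_zero hxd.ne', Real.log_one] at h2
    have e : ((0 - Real.log (x * d)) * (1 - x / κ) + x * (1 / (x * d)) / (κ * A)) * d
      = -(d * Real.log (x * d)) + 1 / κ * (x * d * Real.log (x * d)) + 1 / (κ * A) := by
      field_simp
      ring
    rw [e] at h2
    linarith

lemma mm_integral (κ x : ℝ) (hκ : 0 < κ) (hx : κ < x) :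
    (∫ y in (0:ℝ)..x, mm κ (Real.exp 1 * x / (x - κ)) y)
      - 1 / (κ * (Real.exp 1 * x / (x - κ))) = dualD κ x := by
  have hE : 1 < Real.exp 1 := by simp
  have hlE : Real.log (Real.exp 1) = 1 := Real.log_exp 1
  unfold dualD
  set E := Real.exp 1
  have hx0 : 0 < x := by linarith
  have hxk : 0 < x - κ := by linarith
  have hE1 : 0 < E - 1 := by linarith
  have hE0 : 0 < E := by linarith
  set A := E * x / (x - κ) with hAdef
  have hA0 : 0 < A := by positivity
  have hAm : A * (x - κ) = E * x := by rw [hAdef]; field_simp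
  have hv : 0 < (E - 1) * x + κ := by positivity
  obtain ⟨a, ha⟩ : ∃ a, a = κ * E * x / ((E - 1) * x + κ) := ⟨_, rfl⟩
  have hav : a * ((E - 1) * x + κ) = κ * E * x := by rw [ha]; field_simp
  have ha0 : 0 < a := by rw [ha]; positivity
  have hAa : A * (a - κ) = a := by
    apply mul_left_cancel₀ hxk.ne'
    linear_combination (a - κ) * hAm + hav
  have hak : 0 < a - κ := by
    by_contra hcon
    push Not at hcon
    nlinarith
  have hax : a < x := by
    rw [ha, div_lt_iff₀ hv]
    nlinarith [mul_pos (mul_pos hx0 hE1) hxk]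
  have hA1 : 1 < A := by
    by_contra hcon
    push Not at hcon
    nlinarith
  have hInt : ∀ u v, IntervalIntegrable (mm κ A) volume u v := fun u v =>
    (mm_cont κ A hκ).intervalIntegrable u v
  rw [← intervalIntegral.integral_add_adjacent_intervals (hInt 0 a) (hInt a x)]
  have i1 : ∫ y in (0:ℝ)..a, mm κ A y = a ^ 2 / (2 * (κ * A)) := by
    have : ∫ y in (0:ℝ)..a, mm κ A y = ∫ y in (0:ℝ)..a, y / (κ * A) := by
      apply intervalIntegral.integral_congr
      intro y hy
      rw [Set.uIcc_of_le ha0.le] at hy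
      have hr : rr κ A y = 1 := by
        unfold rr
        apply max_eq_left
        have hm : 0 < max y κ := lt_of_lt_of_le hκ (le_max_right _ _)
        rw [div_le_one hm]
        rcases le_total y κ with h | h
        · rw [max_eq_right h]; nlinarith
        · rw [max_eq_left h]; nlinarith [hy.2]
      simp [mm, hr]
    rw [this, intervalIntegral.integral_div, integral_id]
    field_simp
    ring
  let P : ℝ → ℝ := fun y => (y ^ 2 / (2 * κ) - y) * (1 - (Real.log A + Real.log (y - κ) - Real.log y))
    + y / 2 - κ / 2 * Real.log (y - κ)
  have i2 : ∫ y in a..x, mm κ A y = P x - P a := by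
    apply intervalIntegral.integral_eq_sub_of_hasDerivAt _ (hInt a x)
    intro y hy
    rw [Set.uIcc_of_le hax.le] at hy
    have hy1 : 0 < y - κ := by linarith [hy.1]
    have hy0 : 0 < y := by linarith [hy.1]
    have hr : rr κ A y = A * (y - κ) / y := by
      unfold rr
      rw [max_eq_left (by linarith : κ ≤ y)]
      apply max_eq_right
      rw [le_div_iff₀ hy0]
      nlinarith [hy.1]
    have hm : mm κ A y = (Real.log A + Real.log (y - κ) - Real.log y) * (1 - y / κ)
        + (y - κ) / κ := by
      unfold mm
      rw [hr, Real.log_div (by positivity) hy0.ne', Real.log_mul hA0.ne' hy1.ne']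
      congr 1
      field_simp
    rw [hm]
    have d1 : HasDerivAt (fun y => Real.log (y - κ)) (1 / (y - κ)) y :=
      ((hasDerivAt_id y).sub_const κ).log hy1.ne'
    have d2 : HasDerivAt (fun y => Real.log y) (y⁻¹) y := Real.hasDerivAt_log hy0.ne'
    have d3 : HasDerivAt (fun y : ℝ => y ^ 2 / (2 * κ) - y) (2 * y / (2 * κ) - 1) y := by
      have := (((hasDerivAt_id y).pow 2).div_const (2 * κ)).sub (hasDerivAt_id y)
      refine HasDerivAt.congr_deriv this ?_
      simp
    have d4 := ((d3.mul (((d1.const_add (Real.log A)).sub d2).const_sub 1)).add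
      ((hasDerivAt_id y).div_const 2)).sub (d1.const_mul (κ / 2))
    refine HasDerivAt.congr_deriv (f := P) d4 ?_
    simp only [Pi.sub_apply]
    field_simp
    ring
  rw [i1, i2]
  have l1 : Real.log A + Real.log (x - κ) - Real.log x = 1 := by
    rw [← Real.log_mul hA0.ne' hxk.ne', hAm, Real.log_mul hE0.ne' hx0.ne', hlE]; ring
  have l2 : Real.log A + Real.log (a - κ) - Real.log a = 0 := by
    rw [← Real.log_mul hA0.ne' hak.ne', hAa]; ring
  have l3 : Real.log (((E - 1) * x + κ) / (E * κ)) = Real.log x - Real.log a := by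
    rw [← Real.log_div hx0.ne' ha0.ne']
    congr 1
    rw [div_eq_div_iff (by positivity) ha0.ne']
    linear_combination hav
  have hlog : Real.log (x - κ) = Real.log (a - κ) + 1 + Real.log x - Real.log a := by linarith
  rw [l3]
  simp only [P, l1, l2]
  rw [hlog]
  have q1 : a ^ 2 / (2 * (κ * A)) = a * (a - κ) / (2 * κ) := by
    rw [div_eq_div_iff (by positivity) (by positivity)]
    linear_combination (-2 * κ * a) * hAa
  have q2 : 1 / (κ * A) = (1 - κ / x) / (κ * E) := by
    rw [hAdef]; field_simp
  rw [q1, q2]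
  field_simp
  ring

section analysis
variable {lam : ℝ → ℝ}

lemma lam_cont (hdiff : ∀ σ ∈ Set.Icc (0:ℝ) 1, DifferentiableAt ℝ lam σ) :
    ContinuousOn lam (Set.Icc 0 1) :=
  fun σ hσ => (hdiff σ hσ).continuousAt.continuousWithinAt

lemma lam_mono (hdiff : ∀ σ ∈ Set.Icc (0:ℝ) 1, DifferentiableAt ℝ lam σ)
    (hadm : ∀ σ ∈ Set.Icc (0:ℝ) 1, 0 ≤ deriv lam σ ∧ lam σ * deriv lam σ ≤ 1) :
    MonotoneOn lam (Set.Icc 0 1) := by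
  apply monotoneOn_of_deriv_nonneg (convex_Icc 0 1) (lam_cont hdiff)
  · intro σ hσ
    exact (hdiff σ (interior_subset hσ)).differentiableWithinAt
  · intro σ hσ
    exact (hadm σ (interior_subset hσ)).1

lemma lam_nonneg (hzero : lam 0 = 0) (hmono : MonotoneOn lam (Set.Icc 0 1)) :
    ∀ σ ∈ Set.Icc (0:ℝ) 1, 0 ≤ lam σ := by
  intro σ hσ
  rw [← hzero]
  exact hmono (by simp) hσ hσ.1

lemma lam_deriv_zero (hnn : ∀ σ ∈ Set.Icc (0:ℝ) 1, 0 ≤ lam σ) :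
    ∀ σ ∈ Set.Ioo (0:ℝ) 1, lam σ = 0 → deriv lam σ = 0 := by
  intro σ hσ h
  apply IsLocalMin.deriv_eq_zero
  filter_upwards [isOpen_Ioo.mem_nhds hσ] with τ hτ
  rw [h]
  exact hnn τ (Set.Ioo_subset_Icc_self hτ)

lemma meas_log (hdiff : ∀ σ ∈ Set.Icc (0:ℝ) 1, DifferentiableAt ℝ lam σ) :
    AEMeasurable lam (volume.restrict (Set.Icc (0:ℝ) 1)) :=
  ((lam_cont hdiff).aestronglyMeasurable measurableSet_Icc).aemeasurable

lemma integ_I (hdiff : ∀ σ ∈ Set.Icc (0:ℝ) 1, DifferentiableAt ℝ lam σ)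
    (hadm : ∀ σ ∈ Set.Icc (0:ℝ) 1, 0 ≤ deriv lam σ ∧ lam σ * deriv lam σ ≤ 1)
    (hnn : ∀ σ ∈ Set.Icc (0:ℝ) 1, 0 ≤ lam σ) :
    IntegrableOn (fun σ => lam σ * deriv lam σ * Real.log (lam σ * deriv lam σ))
      (Set.Icc (0:ℝ) 1) := by
  have hm := meas_log hdiff
  have hd : AEMeasurable (deriv lam) (volume.restrict (Set.Icc (0:ℝ) 1)) :=
    (measurable_deriv lam).aemeasurable
  have hp := hm.mul hd
  refine Integrable.mono' (g := fun _ => (1:ℝ)) (integrable_const _)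
    (hp.mul hp.log).aestronglyMeasurable ?_
  refine (ae_restrict_iff' measurableSet_Icc).2 (Filter.Eventually.of_forall ?_)
  intro σ hσ
  have h0 : 0 ≤ lam σ * deriv lam σ := mul_nonneg (hnn σ hσ) (hadm σ hσ).1
  have h1 := (hadm σ hσ).2
  have h2 := Real.negMulLog_le_one_sub_self h0
  have h3 := Real.negMulLog_nonneg h0 h1
  unfold Real.negMulLog at h2 h3
  rw [Real.norm_eq_abs, abs_le]
  constructor <;> linarith

lemma integ_J (hzero : lam 0 = 0) (hdiff : ∀ σ ∈ Set.Icc (0:ℝ) 1, DifferentiableAt ℝ lam σ)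
    (hadm : ∀ σ ∈ Set.Icc (0:ℝ) 1, 0 ≤ deriv lam σ ∧ lam σ * deriv lam σ ≤ 1) :
    IntegrableOn (fun σ => deriv lam σ * Real.log (lam σ * deriv lam σ))
      (Set.Icc (0:ℝ) 1) := by
  have hmono := lam_mono hdiff hadm
  have hnn := lam_nonneg hzero hmono
  have hm := meas_log hdiff
  have hcont := lam_cont hdiff
  have hd : AEMeasurable (deriv lam) (volume.restrict (Set.Icc (0:ℝ) 1)) :=
    (measurable_deriv lam).aemeasurable
  have hp := hm.mul hd
  have hmeas : AEStronglyMeasurable (fun σ => deriv lam σ * Real.log (lam σ * deriv lam σ))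
    (volume.restrict (Set.Icc (0:ℝ) 1)) := (hd.mul hp.log).aestronglyMeasurable
  -- the last zero of `lam`
  obtain ⟨s, hs, hs0, hspos⟩ : ∃ s ∈ Set.Icc (0:ℝ) 1, lam s = 0 ∧
      ∀ σ ∈ Set.Ioc s 1, 0 < lam σ := by
    have hcl : IsClosed (Set.Icc (0:ℝ) 1 ∩ lam ⁻¹' {0}) :=
      hcont.preimage_isClosed_of_isClosed isClosed_Icc isClosed_singleton
    have hcpt : IsCompact (Set.Icc (0:ℝ) 1 ∩ lam ⁻¹' {0}) :=
      isCompact_Icc.of_isClosed_subset hcl Set.inter_subset_left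
    obtain ⟨s, hs, hmax⟩ := hcpt.exists_isGreatest ⟨0, by simp [hzero]⟩
    refine ⟨s, hs.1, hs.2, fun σ hσ => ?_⟩
    have hσ' : σ ∈ Set.Icc (0:ℝ) 1 := ⟨hs.1.1.trans hσ.1.le, hσ.2⟩
    refine lt_of_le_of_ne (hnn σ hσ') fun h => ?_
    have := hmax ⟨hσ', h.symm⟩
    linarith [hσ.1]
  have hz : ∀ σ ∈ Set.Ioo 0 s, deriv lam σ = 0 := by
    intro σ hσ
    have hσ' : σ ∈ Set.Icc (0:ℝ) 1 := ⟨hσ.1.le, hσ.2.le.trans hs.2⟩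
    apply lam_deriv_zero hnn σ ⟨hσ.1, lt_of_lt_of_le hσ.2 hs.2⟩
    apply le_antisymm _ (hnn σ hσ')
    rw [← hs0]
    exact hmono hσ' hs hσ.2.le
  have i1 : IntegrableOn (fun σ => deriv lam σ * Real.log (lam σ * deriv lam σ))
      (Set.Ioo (0:ℝ) s) := by
    apply (integrableOn_zero).congr_fun (f := fun _ => (0:ℝ)) _ measurableSet_Ioo
    intro σ hσ
    simp [hz σ hσ]
  obtain ⟨L, hL, hL1⟩ : ∃ L : ℝ, 0 < L ∧ lam 1 ≤ L := ⟨max 1 (lam 1), by simp, le_max_right _ _⟩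
  have hleL : ∀ σ ∈ Set.Icc (0:ℝ) 1, lam σ ≤ L := fun σ hσ =>
    (hmono hσ (by simp) hσ.2).trans hL1
  have hsub : Set.Icc s 1 ⊆ Set.Icc (0:ℝ) 1 := Set.Icc_subset_Icc_left hs.1
  have i2 : IntegrableOn (fun σ => -(deriv lam σ * (Real.log (lam σ) - Real.log L)))
      (Set.Ioc s 1) := by
    apply intervalIntegral.integrableOn_deriv_of_nonneg
      (g := fun σ => Real.negMulLog (lam σ) + lam σ + lam σ * Real.log L)
    · have h1 := hcont.mono hsub
      exact ((Real.continuous_negMulLog.comp_continuousOn h1).add h1).add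
        (h1.mul continuousOn_const)
    · intro σ hσ
      have hp := hspos σ ⟨hσ.1, hσ.2.le⟩
      have hdl := (hdiff σ (hsub ⟨hσ.1.le, hσ.2.le⟩)).hasDerivAt
      have := (((Real.hasDerivAt_negMulLog hp.ne').comp σ hdl).add hdl).add
        (hdl.mul_const (Real.log L))
      refine HasDerivAt.congr_deriv this ?_
      ring
    · intro σ hσ
      have hp := hspos σ ⟨hσ.1, hσ.2.le⟩
      have hm := hsub ⟨hσ.1.le, hσ.2.le⟩
      have hl := Real.log_le_log hp (hleL σ hm)
      have := (hadm σ hm).1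
      nlinarith
  have i3 : IntegrableOn (fun σ => deriv lam σ) (Set.Ioc s 1) := by
    apply intervalIntegral.integrableOn_deriv_of_nonneg (hcont.mono hsub)
    · intro σ hσ
      exact (hdiff σ (hsub ⟨hσ.1.le, hσ.2.le⟩)).hasDerivAt
    · intro σ hσ
      exact (hadm σ (hsub ⟨hσ.1.le, hσ.2.le⟩)).1
  have i4 : IntegrableOn (fun σ => deriv lam σ * Real.log (lam σ * deriv lam σ))
      (Set.Ioc s 1) := by
    refine Integrable.mono' (((i2.sub (i3.mul_const (Real.log L)))).add
      (integrable_const (1:ℝ)))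
      (hmeas.mono_measure (Measure.restrict_mono (Set.Ioc_subset_Icc_self.trans hsub) le_rfl)) ?_
    refine (ae_restrict_iff' measurableSet_Ioc).2 (Filter.Eventually.of_forall ?_)
    intro σ hσ
    have hp := hspos σ hσ
    have hm := hsub ⟨hσ.1.le, hσ.2⟩
    obtain ⟨h0, h1⟩ := hadm σ hm
    simp only [Pi.add_apply, Pi.sub_apply]
    rcases h0.eq_or_lt with h | h
    · simp [← h]
    · have hlog : Real.log (lam σ * deriv lam σ) ≤ 0 := Real.log_nonpos (by positivity) h1
      rw [Real.norm_eq_abs, abs_of_nonpos (mul_nonpos_of_nonneg_of_nonpos h0 hlog),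
        Real.log_mul hp.ne' h.ne']
      have := Real.negMulLog_le_one_sub_self h0
      unfold Real.negMulLog at this
      nlinarith
  have i5 := i1.union i4
  have : IntegrableOn (fun σ => deriv lam σ * Real.log (lam σ * deriv lam σ))
      (Set.Ioo 0 s ∪ Set.Ioc s 1 ∪ {0} ∪ {s}) := by
    refine (i5.union ?_).union ?_ <;> exact integrableOn_singleton enorm_ne_top (by rw [Real.volume_singleton]; exact ENNReal.zero_lt_top)
  apply this.mono_set
  intro σ hσ
  rcases lt_trichotomy σ s with h | h | h
  · rcases hσ.1.eq_or_lt with h' | h'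
    · simp [← h']
    · left; left; left; exact ⟨h', h⟩
  · simp [h]
  · left; left; right; exact ⟨h, hσ.2⟩

end analysis

lemma phi_ge (κ : ℝ) (hκ : 0 < κ) (lam : ℝ → ℝ) (hzero : lam 0 = 0)
    (hdiff : ∀ σ ∈ Set.Icc (0:ℝ) 1, DifferentiableAt ℝ lam σ)
    (hadm : ∀ σ ∈ Set.Icc (0:ℝ) 1, 0 ≤ deriv lam σ ∧ lam σ * deriv lam σ ≤ 1) :
    dualD κ (max κ (lam 1)) ≤ ∫ σ in (0:ℝ)..1, (-(deriv lam σ * Real.log (lam σ * deriv lam σ))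
      + 1 / κ * (lam σ * deriv lam σ * Real.log (lam σ * deriv lam σ))) := by
  have hmono := lam_mono hdiff hadm
  have hnn := lam_nonneg hzero hmono
  have hφ : IntegrableOn (fun σ => (-(deriv lam σ * Real.log (lam σ * deriv lam σ))
      + 1 / κ * (lam σ * deriv lam σ * Real.log (lam σ * deriv lam σ)))) (Set.Icc (0:ℝ) 1) :=
    (integ_J hzero hdiff hadm).neg.add ((integ_I hdiff hadm hnn).const_mul (1 / κ))
  rcases le_or_gt (lam 1) κ with h | h
  · rw [max_eq_left h, dualD_self κ hκ]
    apply intervalIntegral.integral_nonneg zero_le_one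
    intro σ hσ
    have h1 : lam σ ≤ κ := (hmono hσ (by simp) hσ.2).trans h
    have h2 := hadm σ hσ
    have h3 := mul_nonneg (hnn σ hσ) h2.1
    have h4 := Real.log_nonpos h3 h2.2
    have : (-(deriv lam σ * Real.log (lam σ * deriv lam σ))
      + 1 / κ * (lam σ * deriv lam σ * Real.log (lam σ * deriv lam σ)))
      = deriv lam σ * (-Real.log (lam σ * deriv lam σ)) * ((κ - lam σ) / κ) := by
      field_simp
      ring
    rw [this]
    exact mul_nonneg (mul_nonneg h2.1 (by linarith)) (div_nonneg (by linarith) hκ.le)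
  · rw [max_eq_right h.le, ← mm_integral κ (lam 1) hκ h]
    obtain ⟨A, hA⟩ : ∃ A, A = Real.exp 1 * lam 1 / (lam 1 - κ) := ⟨_, rfl⟩
    rw [← hA]
    have hA0 : 0 < A := by
      have : 0 < lam 1 := by linarith
      have : 0 < lam 1 - κ := by linarith
      rw [hA]; positivity
    let M : ℝ → ℝ := fun x => ∫ y in (0:ℝ)..x, mm κ A y
    have hM : ∀ x, HasDerivAt M (mm κ A x) x := fun x =>
      (mm_cont κ A hκ).integral_hasStrictDerivAt 0 x |>.hasDerivAt
    have hg : ∀ σ ∈ Set.Icc (0:ℝ) 1, HasDerivAt (fun σ => M (lam σ) - 1 / (κ * A) * σ)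
        (mm κ A (lam σ) * deriv lam σ - 1 / (κ * A)) σ := by
      intro σ hσ
      have := ((hM (lam σ)).comp σ (hdiff σ hσ).hasDerivAt).sub
        ((hasDerivAt_id σ).const_mul (1 / (κ * A)))
      refine HasDerivAt.congr_deriv this ?_
      ring
    have := intervalIntegral.sub_le_integral_of_hasDeriv_right_of_le zero_le_one
      (fun σ hσ => (hg σ hσ).continuousAt.continuousWithinAt)
      (fun σ hσ => (hg σ (Set.Ioo_subset_Icc_self hσ)).hasDerivWithinAt) hφ ?_
    · refine le_trans (le_of_eq ?_) this
      simp [M, hzero]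
    · intro σ hσ
      have hσ' := Set.Ioo_subset_Icc_self hσ
      rcases (hnn σ hσ').eq_or_lt with h0 | h0
      · rw [lam_deriv_zero hnn σ hσ h0.symm]
        simp
        positivity
      · exact pw κ A (lam σ) (deriv lam σ) hκ hA0 h0 (hadm σ hσ').1 (hadm σ hσ').2


/-- Theorem 1, part 1 (optimality): for `b ∈ (√(2/e), √2)`, with
`k = K(b)`, `a`, `q(b)` and `J_min(b)` as in the paper, every admissible
function `λ` (`λ(0) = 0`, `λ' ≥ 0`, `λλ' ≤ 1`) with `I[λ] = q(b)` satisfies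
`J[λ] ≥ J_min(b)`. -/
theorem drag_ge_Jmin
    (b : ℝ) (hb : b ∈ Set.Ioo (Real.sqrt (2 / Real.exp 1)) (Real.sqrt 2))
    (k a q Jmin : ℝ)
    (hk : k = -((Real.exp 1 - 1) * b * (b ^ 2 * Real.exp 1 - 2)) /
      (2 + (Real.exp 1 - 2) * b ^ 2 * Real.exp 1))
    (ha : a = (b ^ 2 * Real.exp 1 - 2) / ((Real.exp 1 - 1) * b))
    (hq : q = (1 / 2) * (b ^ 2 - k ^ 2 + k * (b - a) - k ^ 2 * Real.log (b / a)))
    (hJmin : Jmin = Real.sqrt 2 * (k * Real.log (b / a) + b + k))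
    (lam : ℝ → ℝ)
    (hzero : lam 0 = 0)
    (hdiff : ∀ σ ∈ Set.Icc (0:ℝ) 1, DifferentiableAt ℝ lam σ)
    (hadm : ∀ σ ∈ Set.Icc (0:ℝ) 1, 0 ≤ deriv lam σ ∧ lam σ * deriv lam σ ≤ 1)
    (hI : lamLift lam = q) :
    lamDrag lam ≥ Jmin := by
  obtain ⟨hb0, hk0, hT, hJ⟩ := params b hb k a q Jmin hk ha hq hJmin
  have hκ : 0 < -k := by linarith
  have h1 := phi_ge (-k) hκ lam hzero hdiff hadm
  have h2 := dualD_ge (-k) b (max (-k) (lam 1)) hκ hb0 (lt_of_lt_of_le hκ (le_max_left _ _)) hT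
  have hnn := lam_nonneg hzero (lam_mono hdiff hadm)
  have iJ := (intervalIntegrable_iff_integrableOn_Icc_of_le zero_le_one).2
    (integ_J hzero hdiff hadm)
  have iI := (intervalIntegrable_iff_integrableOn_Icc_of_le zero_le_one).2
    (integ_I hdiff hadm hnn)
  have iJn : IntervalIntegrable (fun σ => -(deriv lam σ * Real.log (lam σ * deriv lam σ)))
      volume 0 1 := iJ.neg
  rw [intervalIntegral.integral_add iJn (iI.const_mul _), intervalIntegral.integral_neg,
    intervalIntegral.integral_const_mul] at h1
  unfold lamLift at hI
  unfold lamDrag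
  rw [hJ, ge_iff_le, neg_mul, ← mul_neg]
  apply mul_le_mul_of_nonneg_left _ (Real.sqrt_nonneg 2)
  rw [← hI]
  have e : ∀ z : ℝ, -z / -k = -(1 / -k * z) := fun z => by ring
  rw [e]
  linarith
end

section
/- (Theorem 2, minimum drag and maximum lift-to-drag ratio.) Fix b ∈ (√(2/e), √2) and set k = K(b) = -(e-1)b(b²e - 2)/(2 + (e-2)b²e), a = (b²e - 2)/((e-1)b), q(b) = (1/2)[b² - k² + k(b - a) - k² log(b/a)], and J_min(b) = √2 (k log(b/a) + b + k). Then for every ε ∈ [0,1) and all measurable u₁, u₂ : [0,1] → ℝ with 0 ≤ uᵢ(σ) ≤ 1 such that the lift coefficient C_L = 2{(1-ε) I[u₂] - ε I[u₁]} equals 2 q(b), the drag coefficient C_D = (1/(2π)) (√(1-ε) J[u₂] + √ε J[u₁])² satisfies C_D ≥ (1/(2π)) J_min(b)², and hence the lift-to-drag ratio κ = C_L/C_D satisfies κ ≤ 4π q(b)/J_min(b)². -/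
open MeasureTheory Real

/-- The lift functional `I[u] = -∫₀¹ u(σ) log u(σ) dσ`. -/
noncomputable def liftFunctional (u : ℝ → ℝ) : ℝ :=
  -∫ σ in (0:ℝ)..1, u σ * Real.log (u σ)

/-- The drag functional `J[u] = -∫₀¹ (u log u)/√(∫₀^σ u) dσ`. -/
noncomputable def dragFunctional (u : ℝ → ℝ) : ℝ :=
  -∫ σ in (0:ℝ)..1, (u σ * Real.log (u σ)) / Real.sqrt (∫ t in (0:ℝ)..σ, u t)

lemma exists_cont_inverse (R : ℝ → ℝ) (a b : ℝ) (hab : a ≤ b)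
    (hc : ContinuousOn R (Set.Icc a b)) (hm : StrictMonoOn R (Set.Icc a b)) :
    ∃ Y : ℝ → ℝ, Continuous Y ∧ (∀ P, Y P ∈ Set.Icc a b) ∧
      (∀ y ∈ Set.Icc a b, Y (R y) = y) ∧
      (∀ P ∈ Set.Icc (R a) (R b), ∃ y ∈ Set.Icc a b, R y = P) := by
  set c : ℝ → ℝ := fun y => max a (min b y) with hcdef
  have hcI : ∀ y, c y ∈ Set.Icc a b := fun y => ⟨le_max_left _ _, max_le hab (min_le_left _ _)⟩
  have hcid : ∀ y ∈ Set.Icc a b, c y = y := fun y hy => by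
    simp only [hcdef]; rw [min_eq_right hy.2, max_eq_right hy.1]
  have hcc : Continuous c := by fun_prop
  have hcm : Monotone c := fun x y h => max_le_max le_rfl (min_le_min le_rfl h)
  set T : ℝ → ℝ := fun y => R (c y) + (y - c y) with hT
  have hTc : Continuous T := by
    have : Continuous (fun y => R (c y)) := hc.comp_continuous hcc hcI
    exact this.add (continuous_id.sub hcc)
  have hRm : Monotone (fun y => R (c y)) := fun x y h => hm.monotoneOn (hcI x) (hcI y) (hcm h)
  have hsub : Monotone (fun y => y - c y) := by
    intro x y h
    simp only [hcdef]
    grind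
  have hTs : StrictMono T := by
    intro x y h
    have h1 := hRm h.le
    have h2 := hsub h.le
    simp only [hT] at *
    rcases (hcm h.le).lt_or_eq with h3 | h3
    · have := hm (hcI x) (hcI y) h3
      linarith
    · rw [h3] at *
      linarith
  have hTsurj : Function.Surjective T := by
    apply hTc.surjective
    · refine Filter.tendsto_atTop_mono (f := fun y => R a + (y - b)) ?_ ?_
      · intro y
        have := hm.monotoneOn (Set.left_mem_Icc.2 hab) (hcI y) (hcI y).1
        have := (hcI y).2
        simp only [hT]; linarith
      · apply Filter.tendsto_atTop_add_const_left
        exact Filter.tendsto_atTop_add_const_right _ _ Filter.tendsto_id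
    · refine Filter.tendsto_atBot_mono (f := fun y => R b + (y - a)) ?_ ?_
      · intro y
        have := hm.monotoneOn (hcI y) (Set.right_mem_Icc.2 hab) (hcI y).2
        have := (hcI y).1
        simp only [hT]; linarith
      · apply Filter.tendsto_atBot_add_const_left
        exact Filter.tendsto_atBot_add_const_right _ _ Filter.tendsto_id
  let O := StrictMono.orderIsoOfSurjective T hTs hTsurj
  refine ⟨fun P => c (O.symm P), hcc.comp O.symm.continuous, fun P => hcI _, ?_, ?_⟩
  · intro y hy
    have : R y = O y := by
      show R y = R (c y) + (y - c y)
      rw [hcid y hy]; ring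
    simp only [this, OrderIso.symm_apply_apply]
    exact hcid y hy
  · intro P hP
    exact intermediate_value_Icc hab hc hP

lemma tangent_ineq (v s : ℝ) (hv : 0 ≤ v) : exp s * ((1 - s) * v + negMulLog v) ≤ 1 := by
  rcases hv.eq_or_lt with rfl | hv
  · simp
  · have h := Real.add_one_le_exp (-s - log v)
    have h2 : exp (-s - log v) = (exp s)⁻¹ * v⁻¹ := by
      rw [exp_sub, exp_neg, exp_log hv]; rfl
    rw [h2] at h
    have : exp s * ((1 - s) * v + negMulLog v) = exp s * v * (-s - log v + 1) := by
      unfold negMulLog; ring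
    rw [this]
    calc exp s * v * (-s - log v + 1) ≤ exp s * v * ((exp s)⁻¹ * v⁻¹) := by gcongr
      _ = 1 := by field_simp

lemma convex_ineq (y φ : ℝ) (hy : 0 < y) (hφ : 0 < φ) :
    3 / (√2 * y) - √2 * φ / y ^ 3 ≤ 1 / √φ := by
  set z := √φ with hz
  have hz0 : 0 < z := Real.sqrt_pos.2 hφ
  have hzz : φ = z ^ 2 := (Real.sq_sqrt hφ.le).symm
  have hr : 0 < √2 := by positivity
  have hr2 : √2 ^ 2 = 2 := Real.sq_sqrt (by norm_num)
  obtain ⟨c, hc, rfl⟩ : ∃ c, 0 < c ∧ y = √2 * c := ⟨y / √2, by positivity, by field_simp⟩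
  rw [hzz]
  have e1 : 3 / (√2 * (√2 * c)) - √2 * z ^ 2 / (√2 * c) ^ 3 = (3 * c ^ 2 - z ^ 2) / (2 * c ^ 3) := by
    have : √2 * (√2 * c) = 2 * c := by rw [← mul_assoc, ← sq, hr2]
    rw [this]
    have : (√2 * c) ^ 3 = √2 * (2 * c ^ 3) := by
      rw [mul_pow, pow_succ, hr2]; ring
    rw [this, mul_div_mul_left _ _ hr.ne']
    field_simp
  rw [e1, div_le_div_iff₀ (by positivity) hz0]
  nlinarith [mul_nonneg (sq_nonneg (z - c)) (by positivity : 0 ≤ z + 2 * c)]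

lemma calibration (a b k A : ℝ) (ha : 0 < a) (hab : a < b) (hk : k < 0) (hA : 0 < A)
    (hak : 0 < a + k) (h1 : A * (a + k) = a) (h2 : A * (b + k) = exp 1 * b)
    (q S ν : ℝ) (hν : ν = -√2 / (A * k))
    (hq : q = (1 / 2) * (b ^ 2 - k ^ 2 + k * (b - a) - k ^ 2 * Real.log (b / a)))
    (hS : S = k * Real.log (b / a) + b + k) :
    0 < q ∧ 0 < S ∧ ∃ (ψ Θ ρ θ : ℝ → ℝ) (C : NNReal), LipschitzWith C ψ ∧ LipschitzWith C Θ ∧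
      (∀ P, HasDerivAt ψ (-ρ P) P) ∧ (∀ P, HasDerivAt Θ (θ P) P) ∧ ψ q = 0 ∧
      Θ q - Θ 0 = S / √2 + ν * A * q ∧
      ∀ P ∈ Set.Icc 0 q, ∀ v φ : ℝ, 0 ≤ v → v ≤ 1 → 0 < φ →
        -ρ P * φ * negMulLog v + ψ P * v + θ P * negMulLog v - ν ≤ negMulLog v / √φ := by
  have hr : 0 < √2 := by positivity
  have hr2 : √2 ^ 2 = 2 := Real.sq_sqrt (by norm_num)
  have hν0 : 0 < ν := by
    rw [hν]; exact div_pos_of_neg_of_neg (by linarith) (mul_neg_of_pos_of_neg hA hk)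
  have hνk : ν * A * k = -√2 := by
    have := hk.ne; rw [hν]; field_simp
  set s : ℝ → ℝ := fun y => log (A * (y + k) / y) with hs
  set R : ℝ → ℝ := fun y => y ^ 2 / 2 * s y + k * (y - a) / 2 - k ^ 2 / 2 * log ((y + k) / (a + k)) with hR
  set T : ℝ → ℝ := fun y => y * s y + k * log ((y + k) / (a + k)) with hT
  have hsa : s a = 0 := by simp [hs, h1, ha.ne']
  have hb : 0 < b := ha.trans hab
  have hsb : s b = 1 := by simp [hs, h2, hb.ne']
  have hRa : R a = 0 := by simp [hR, hsa, hak.ne']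
  have hTa : T a = 0 := by simp [hT, hsa, hak.ne']
  have hlog : log ((b + k) / (a + k)) = 1 + log (b / a) := by
    have : (b + k) / (a + k) = exp 1 * (b / a) := by
      have e1 : b + k = exp 1 * b / A := by field_simp; linarith
      have e2 : a + k = a / A := by field_simp; linarith
      rw [e1, e2]; field_simp
    rw [this, log_mul (exp_pos _).ne' (by positivity), log_exp]
  have hRb : R b = q := by simp only [hR, hsb, hlog, hq]; ring
  have hTb : T b = S := by simp only [hT, hsb, hlog, hS]; ring
  have hes : ∀ y, a ≤ y → exp (s y) = A * (y + k) / y := fun y hy => by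
    have : 0 < y + k := by linarith
    have : 0 < y := by linarith
    exact exp_log (by positivity)
  have ds : ∀ y, a ≤ y → HasDerivAt s (-k / (y * (y + k))) y := by
    intro y hy
    have p1 : 0 < y + k := by linarith
    have p2 : 0 < y := by linarith
    have := (((((hasDerivAt_id' y).add_const k).const_mul A).fun_div (hasDerivAt_id' y) p2.ne').log
      (show 0 < A * (y + k) / y by positivity).ne')
    refine HasDerivAt.congr_deriv (f := s) this ?_
    field_simp
    ring
  have dl : ∀ y, a ≤ y → HasDerivAt (fun y => log ((y + k) / (a + k))) (1 / (y + k)) y := by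
    intro y hy
    have p1 : 0 < y + k := by linarith
    have := ((((hasDerivAt_id' y).add_const k).div_const (a + k))).log (by positivity)
    refine HasDerivAt.congr_deriv this ?_
    field_simp
  have dR : ∀ y, a ≤ y → HasDerivAt R (y * s y) y := by
    intro y hy
    have p1 : 0 < y + k := by linarith
    have p2 : 0 < y := by linarith
    have := (((((hasDerivAt_id' y).fun_pow 2).div_const 2).fun_mul (ds y hy)).fun_add
      ((((hasDerivAt_id' y).sub_const a).const_mul k).div_const 2)).fun_sub ((dl y hy).const_mul (k ^ 2 / 2))
    refine HasDerivAt.congr_deriv (f := R) this ?_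
    field_simp
    push_cast
    ring
  have dT : ∀ y, a ≤ y → HasDerivAt T (s y) y := by
    intro y hy
    have p1 : 0 < y + k := by linarith
    have p2 : 0 < y := by linarith
    have := ((hasDerivAt_id' y).fun_mul (ds y hy)).fun_add ((dl y hy).const_mul k)
    refine HasDerivAt.congr_deriv (f := T) this ?_
    field_simp
    ring
  have hspos : ∀ y, a < y → 0 < s y := by
    intro y hy
    have p2 : 0 < y := by linarith
    apply log_pos
    rw [lt_div_iff₀ p2]
    have : A * k < 0 := mul_neg_of_pos_of_neg hA hk
    have : 1 < A := by nlinarith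
    nlinarith
  have cR : ContinuousOn R (Set.Icc a b) := fun y hy => (dR y hy.1).continuousAt.continuousWithinAt
  have cT : ContinuousOn T (Set.Icc a b) := fun y hy => (dT y hy.1).continuousAt.continuousWithinAt
  have mR : StrictMonoOn R (Set.Icc a b) := by
    apply strictMonoOn_of_deriv_pos (convex_Icc a b) cR
    intro y hy
    rw [interior_Icc] at hy
    rw [(dR y hy.1.le).deriv]
    exact mul_pos (by linarith [hy.1]) (hspos y hy.1)
  have mT : StrictMonoOn T (Set.Icc a b) := by
    apply strictMonoOn_of_deriv_pos (convex_Icc a b) cT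
    intro y hy
    rw [interior_Icc] at hy
    rw [(dT y hy.1.le).deriv]
    exact (hspos y hy.1)
  have hla := Set.left_mem_Icc.2 hab.le
  have hrb := Set.right_mem_Icc.2 hab.le
  refine ⟨by rw [← hRb, ← hRa]; exact mR hla hrb hab, by rw [← hTb, ← hTa]; exact mT hla hrb hab, ?_⟩
  obtain ⟨Y, cY, YI, hYR, hsurj⟩ := exists_cont_inverse R a b hab.le cR mR
  have Ypos : ∀ P, 0 < Y P := fun P => ha.trans_le (YI P).1
  set ρ : ℝ → ℝ := fun P => √2 / (Y P) ^ 3 with hρ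
  set θ : ℝ → ℝ := fun P => 3 / (√2 * Y P) + ν * (A * (Y P + k) / Y P) with hθ
  have cρ : Continuous ρ := by
    apply continuous_const.div (by fun_prop); intro P; have := Ypos P; positivity
  have cθ : Continuous θ := by
    apply Continuous.add
    · apply continuous_const.div (by fun_prop); intro P; have := Ypos P; positivity
    · apply Continuous.mul continuous_const
      apply Continuous.div (by fun_prop) (by fun_prop); intro P; exact (Ypos P).ne'
  have bρ : ∀ P, |ρ P| ≤ √2 / a ^ 3 := by
    intro P
    have := Ypos P
    rw [abs_of_pos (by positivity)]
    simp only [hρ]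
    gcongr
    exact (YI P).1
  have bθ : ∀ P, |θ P| ≤ 3 / (√2 * a) + ν * A := by
    intro P
    have h3 := Ypos P
    have h4 := (YI P).1
    have : 0 < Y P + k := by linarith
    rw [abs_of_pos (by positivity)]
    simp only [hθ]
    gcongr
    rw [div_le_iff₀ h3]
    nlinarith
  set ψ : ℝ → ℝ := fun P => -∫ t in q..P, ρ t with hψ
  set Θ : ℝ → ℝ := fun P => ∫ t in (0:ℝ)..P, θ t with hΘ
  have dψ : ∀ P, HasDerivAt ψ (-ρ P) P := fun P => (cρ.integral_hasStrictDerivAt q P).hasDerivAt.neg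
  have dΘ : ∀ P, HasDerivAt Θ (θ P) P := fun P => (cθ.integral_hasStrictDerivAt 0 P).hasDerivAt
  have hψR : ∀ y ∈ Set.Icc a b, ψ (R y) = ν * exp (s y) * (1 - s y) := by
    intro y hy
    have key : ∀ z ∈ Set.Icc a b, HasDerivAt (fun z => ψ (R z) - ν * exp (s z) * (1 - s z)) 0 z := by
      intro z hz
      have p2 : 0 < z := by linarith [hz.1]
      have p1 : 0 < z + k := by linarith [hz.1]
      have := ((dψ (R z)).comp z (dR z hz.1)).fun_sub
        ((((ds z hz.1).exp).const_mul ν).fun_mul ((ds z hz.1).const_sub 1))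
      refine HasDerivAt.congr_deriv this ?_
      simp only [hρ, hYR z hz, hes z hz.1]
      have : k = - √2 / (ν * A) := by field_simp; linarith
      have e : ν * (A * (z + k) / z * (-k / (z * (z + k)))) = √2 / z ^ 2 := by
        rw [← neg_neg √2, ← hνk]; field_simp
      have e' : ν * (A * (z + k) / z) * -(-k / (z * (z + k))) = -(√2 / z ^ 2) := by
        rw [← e]; ring
      rw [e, e']
      field_simp
      ring
    have := constant_of_derivWithin_zero (a := a) (b := b) (f := fun z => ψ (R z) - ν * exp (s z) * (1 - s z))
      (fun z hz => (key z hz).differentiableAt.differentiableWithinAt)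
      (fun z hz => ((key z ⟨hz.1, hz.2.le⟩).hasDerivWithinAt).derivWithin
        (uniqueDiffOn_Icc hab z ⟨hz.1, hz.2.le⟩))
    have e1 := this y hy
    have e2 := this b hrb
    simp only [hRb, hsb] at e1 e2
    have : ψ q = 0 := by simp [hψ]
    linarith
  have hΘR : ∀ y ∈ Set.Icc a b, Θ (R y) = T y / √2 + ν * A * R y := by
    intro y hy
    have key : ∀ z ∈ Set.Icc a b, HasDerivAt (fun z => Θ (R z) - (T z / √2 + ν * A * R z)) 0 z := by
      intro z hz
      have p2 : 0 < z := by linarith [hz.1]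
      have := ((dΘ (R z)).comp z (dR z hz.1)).fun_sub
        (((dT z hz.1).div_const √2).fun_add ((dR z hz.1).const_mul (ν * A)))
      refine HasDerivAt.congr_deriv this ?_
      simp only [hθ, hYR z hz]
      have e : ν * (A * (z + k) / z) * (z * s z) = ν * A * z * s z + ν * A * k * s z := by
        field_simp
      rw [add_mul, e, hνk]
      field_simp
      linear_combination (-s z) * hr2
    have := constant_of_derivWithin_zero (a := a) (b := b) (f := fun z => Θ (R z) - (T z / √2 + ν * A * R z))
      (fun z hz => (key z hz).differentiableAt.differentiableWithinAt)
      (fun z hz => ((key z ⟨hz.1, hz.2.le⟩).hasDerivWithinAt).derivWithin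
        (uniqueDiffOn_Icc hab z ⟨hz.1, hz.2.le⟩))
    have e1 := this y hy
    simp only [hRa, hTa] at e1
    have : Θ 0 = 0 := by simp [hΘ]
    rw [this] at e1
    simp at e1
    linarith
  set C : ℝ := max (√2 / a ^ 3) (3 / (√2 * a) + ν * A) with hC
  have hC0 : 0 ≤ C := le_max_of_le_left (by positivity)
  refine ⟨ψ, Θ, ρ, θ, C.toNNReal, ?_, ?_, dψ, dΘ, by simp [hψ], ?_, ?_⟩
  · apply lipschitzWith_of_nnnorm_deriv_le (fun P => (dψ P).differentiableAt)
    intro P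
    rw [(dψ P).deriv, ← NNReal.coe_le_coe, coe_nnnorm, Real.coe_toNNReal _ hC0, norm_neg]
    exact (bρ P).trans (le_max_left _ _)
  · apply lipschitzWith_of_nnnorm_deriv_le (fun P => (dΘ P).differentiableAt)
    intro P
    rw [(dΘ P).deriv, ← NNReal.coe_le_coe, coe_nnnorm, Real.coe_toNNReal _ hC0]
    exact (bθ P).trans (le_max_right _ _)
  · rw [← hRb, hΘR b hrb, hTb]; simp [hΘ]
  · intro P hP v φ hv0 hv1 hφ
    rw [← hRb] at hP
    rw [← hRa] at hP
    obtain ⟨y, hy, rfl⟩ := hsurj P hP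
    have p2 : 0 < y := by linarith [hy.1]
    have i1 := tangent_ineq v (s y) hv0
    have i2 := convex_ineq y φ p2 hφ
    have hh : 0 ≤ negMulLog v := negMulLog_nonneg hv0 hv1
    simp only [hρ, hθ, hYR y hy, hψR y hy, ← hes y hy.1]
    have i3 := mul_le_mul_of_nonneg_left i1 hν0.le
    have i4 := mul_le_mul_of_nonneg_right i2 hh
    have : negMulLog v / √φ = 1 / √φ * negMulLog v := by ring
    rw [this]
    have e : -(√2 / y ^ 3) * φ * negMulLog v = - (√2 * φ / y ^ 3) * negMulLog v := by ring
    rw [e]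
    rw [sub_mul] at i4
    rw [mul_add, mul_add, ← mul_assoc, ← mul_assoc] at i3
    linarith

lemma negMulLog_le_one (v : ℝ) (hv : 0 ≤ v) : negMulLog v ≤ 1 := by
  have := tangent_ineq v 0 hv
  simp at this; linarith

lemma intervalIntegrable_of_bdd (f : ℝ → ℝ) (hf : Measurable f) (h0 : ∀ x, 0 ≤ f x)
    (h1 : ∀ x, f x ≤ 1) (a b : ℝ) : IntervalIntegrable f volume a b := by
  refine IntervalIntegrable.mono_fun (intervalIntegrable_const (c := (1:ℝ)))
    hf.aestronglyMeasurable ?_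
  refine Filter.Eventually.of_forall fun x => ?_
  simp only [norm_eq_abs, abs_of_nonneg (h0 x), abs_one]
  exact h1 x

lemma lipschitz_primitive (f : ℝ → ℝ) (hf : Measurable f) (h0 : ∀ x, 0 ≤ f x)
    (h1 : ∀ x, f x ≤ 1) : LipschitzWith 1 (fun x => ∫ t in (0:ℝ)..x, f t) := by
  refine LipschitzWith.of_dist_le_mul fun x y => ?_
  have I := intervalIntegrable_of_bdd f hf h0 h1
  rw [dist_eq_norm, intervalIntegral.integral_interval_sub_left (I _ _) (I _ _)]
  have := intervalIntegral.norm_integral_le_of_norm_le_const (a := y) (b := x) (f := f) (C := 1)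
    (fun t _ => by rw [norm_eq_abs, abs_of_nonneg (h0 t)]; exact h1 t)
  simpa [Real.dist_eq] using this

lemma mono_primitive (f : ℝ → ℝ) (hf : Measurable f) (h0 : ∀ x, 0 ≤ f x)
    (h1 : ∀ x, f x ≤ 1) : Monotone (fun x => ∫ t in (0:ℝ)..x, f t) := by
  intro x y h
  have I := intervalIntegrable_of_bdd f hf h0 h1
  have := intervalIntegral.integral_interval_sub_left (I 0 y) (I 0 x)
  have := intervalIntegral.integral_nonneg (μ := volume) h (fun t _ => h0 t)
  simp only
  linarith

lemma deriv_primitive (f : ℝ → ℝ) (hf : Measurable f) (h0 : ∀ x, 0 ≤ f x)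
    (h1 : ∀ x, f x ≤ 1) : ∀ᵐ x, HasDerivAt (fun x => ∫ t in (0:ℝ)..x, f t) (f x) x := by
  have : LocallyIntegrable f volume := by
    refine (locallyIntegrable_const (1:ℝ)).mono hf.aestronglyMeasurable ?_
    refine Filter.Eventually.of_forall fun x => ?_
    simp only [norm_eq_abs, abs_of_nonneg (h0 x), abs_one]
    exact h1 x
  filter_upwards [_root_.LocallyIntegrable.ae_hasDerivAt_integral this] with x hx using hx 0

lemma negMulLog_bound (v : ℝ) (hv : 0 ≤ v) : negMulLog v ≤ 3 * v ^ (2/3 : ℝ) := by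
  rcases hv.eq_or_lt with rfl | hv
  · simp
  · have := Real.log_le_rpow_div (x := v⁻¹) (by positivity) (show (0:ℝ) < 1/3 by norm_num)
    rw [log_inv, inv_rpow hv.le, ← rpow_neg hv.le] at this
    have h2 : v ^ (2/3 : ℝ) = v * v ^ (-(1/3) : ℝ) := by
      rw [← rpow_one_add' hv.le (by norm_num)]; norm_num
    rw [h2]
    unfold negMulLog
    have := mul_le_mul_of_nonneg_left this hv.le
    linarith

lemma rpow_bound (x : ℝ) (hx : 0 ≤ x) : x ^ (2/3 : ℝ) ≤ 1 + x := by
  rcases le_total x 1 with h | h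
  · have := rpow_le_one hx h (show (0:ℝ) ≤ 2/3 by norm_num); linarith
  · have := rpow_le_rpow_of_exponent_le h (show (2/3:ℝ) ≤ 1 by norm_num)
    rw [rpow_one] at this; linarith

lemma drag_integrable (v : ℝ → ℝ) (hm : Measurable v) (h0 : ∀ x, 0 ≤ v x) (h1 : ∀ x, v x ≤ 1) :
    IntervalIntegrable (fun σ => negMulLog (v σ) / √(∫ t in (0:ℝ)..σ, v t)) volume 0 1 := by
  set φ : ℝ → ℝ := fun x => ∫ t in (0:ℝ)..x, v t with hφ
  have mφ : Monotone φ := mono_primitive v hm h0 h1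
  have cφ : Continuous φ := (lipschitz_primitive v hm h0 h1).continuous
  have φ0 : φ 0 = 0 := by simp [hφ]
  have φnn : ∀ x, 0 ≤ x → 0 ≤ φ x := fun x hx => φ0 ▸ mφ hx
  set F : ℝ → ℝ := fun x => φ x ^ (1/4 : ℝ) with hF
  have mF : MonotoneOn F (Set.uIcc 0 1) := by
    intro x hx y hy hxy
    rw [Set.uIcc_of_le zero_le_one] at hx
    exact rpow_le_rpow (φnn x hx.1) (mφ hxy) (by norm_num)
  have iF := mF.intervalIntegrable_deriv
  have iB : IntervalIntegrable (fun x => 3 * (1 + 4 * |deriv F x|)) volume 0 1 :=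
    ((intervalIntegrable_const (c := (1:ℝ))).add (iF.abs.const_mul 4)).const_mul 3
  refine iB.mono_fun ?_ ?_
  · apply Measurable.aestronglyMeasurable
    have : Measurable φ := cφ.measurable
    have h2 : Measurable (fun σ => negMulLog (v σ)) := continuous_negMulLog.measurable.comp hm
    exact h2.div this.sqrt
  · rw [Filter.EventuallyLE, ae_restrict_iff' measurableSet_uIoc]
    filter_upwards [deriv_primitive v hm h0 h1] with x hx hx01
    rw [Set.uIoc_of_le zero_le_one] at hx01
    have hh : 0 ≤ negMulLog (v x) := negMulLog_nonneg (h0 x) (h1 x)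
    rw [norm_eq_abs, norm_eq_abs, abs_of_nonneg (by positivity), abs_of_nonneg (by positivity)]
    change negMulLog (v x) / √(φ x) ≤ _
    rcases (φnn x hx01.1.le).eq_or_lt with hz | hpos
    · rw [← hz]; simp; positivity
    · have hd : deriv F x = v x * (1/4 : ℝ) * φ x ^ (1/4 - 1 : ℝ) :=
        (HasDerivAt.rpow_const (p := 1/4) (f := φ) hx (Or.inl hpos.ne')).deriv
      have hd' : 4 * |deriv F x| = v x * φ x ^ (-(3/4) : ℝ) := by
        have := h0 x
        rw [hd, abs_of_nonneg (by positivity)]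
        norm_num
        ring
      rw [hd']
      have e : negMulLog (v x) / √(φ x) ≤ 3 * (v x * φ x ^ (-(3/4) : ℝ)) ^ (2/3 : ℝ) := by
        rw [mul_rpow (h0 x) (by positivity), ← rpow_mul hpos.le, div_eq_mul_inv, sqrt_eq_rpow,
          ← rpow_neg hpos.le, ← mul_assoc]
        norm_num
        exact mul_le_mul_of_nonneg_right (by have := negMulLog_bound (v x) (h0 x); norm_num at this; exact this) (by positivity)
      refine e.trans ?_
      have := rpow_bound (v x * φ x ^ (-(3/4) : ℝ)) (by have := h0 x; positivity)
      linarith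

lemma time_bound (v : ℝ → ℝ) (hm : Measurable v) (h0 : ∀ x, 0 ≤ v x) (h1 : ∀ x, v x ≤ 1)
    (l q ν : ℝ) (hl0 : 0 < l) (hl1 : l ≤ 1) (hq : 0 < q) (hν : 0 ≤ ν)
    (hI : q ≤ l * ∫ σ in (0:ℝ)..1, negMulLog (v σ))
    (ψ Θ ρ θ : ℝ → ℝ) (C : NNReal) (lψ : LipschitzWith C ψ) (lΘ : LipschitzWith C Θ)
    (dψ : ∀ P, HasDerivAt ψ (-ρ P) P) (dΘ : ∀ P, HasDerivAt Θ (θ P) P) (hψq : ψ q = 0)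
    (key : ∀ P ∈ Set.Icc 0 q, ∀ v φ : ℝ, 0 ≤ v → v ≤ 1 → 0 < φ →
        -ρ P * φ * negMulLog v + ψ P * v + θ P * negMulLog v - ν ≤ negMulLog v / √φ) :
    Θ q - Θ 0 - ν ≤ √l * ∫ σ in (0:ℝ)..1, negMulLog (v σ) / √(∫ t in (0:ℝ)..σ, v t) := by
  have iJ := drag_integrable v hm h0 h1
  set H : ℝ → ℝ := fun σ => negMulLog (v σ) with hH
  have Hm : Measurable H := continuous_negMulLog.measurable.comp hm
  have H0 : ∀ x, 0 ≤ H x := fun x => negMulLog_nonneg (h0 x) (h1 x)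
  have H1 : ∀ x, H x ≤ 1 := fun x => negMulLog_le_one _ (h0 x)
  set φ : ℝ → ℝ := fun x => ∫ t in (0:ℝ)..x, v t with hφ
  set p : ℝ → ℝ := fun x => ∫ t in (0:ℝ)..x, H t with hp
  have mφ : Monotone φ := mono_primitive v hm h0 h1
  have lφ : LipschitzWith 1 φ := lipschitz_primitive v hm h0 h1
  have φ0 : φ 0 = 0 := by simp [hφ]
  have φnn : ∀ x, 0 ≤ x → 0 ≤ φ x := fun x hx => φ0 ▸ mφ hx
  have mp : Monotone p := mono_primitive H Hm H0 H1
  have lp : LipschitzWith 1 p := lipschitz_primitive H Hm H0 H1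
  have p0 : p 0 = 0 := by simp [hp]
  have lP : LipschitzWith (Real.nnabs l * 1) (fun x => l * p x) := by
    refine LipschitzWith.of_dist_le_mul fun x y => ?_
    have := lp.dist_le_mul x y
    simp only [Real.dist_eq, ← mul_sub, abs_mul] at *
    push_cast at *
    simp only [mul_one, one_mul] at *
    gcongr
  obtain ⟨τ, hτ, hτq⟩ : ∃ τ ∈ Set.Icc (0:ℝ) 1, l * p τ = q := by
    have := intermediate_value_Icc (f := fun x => l * p x) zero_le_one lP.continuous.continuousOn
    apply this
    simp only [p0, mul_zero]
    exact ⟨hq.le, hI⟩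
  set G : ℝ → ℝ := fun x => ψ (l * p x) * (l * φ x) + (Θ (l * p x) - ν * l * x) with hG
  have aψ : AbsolutelyContinuousOnInterval (fun x => ψ (l * p x)) 0 τ :=
    ((lψ.comp lP).lipschitzOnWith).absolutelyContinuousOnInterval
  have aΘ : AbsolutelyContinuousOnInterval (fun x => Θ (l * p x)) 0 τ :=
    ((lΘ.comp lP).lipschitzOnWith).absolutelyContinuousOnInterval
  have aφ : AbsolutelyContinuousOnInterval (fun x => l * φ x) 0 τ :=
    (lφ.lipschitzOnWith.absolutelyContinuousOnInterval).const_mul l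
  have aid : AbsolutelyContinuousOnInterval (fun x => ν * l * x) 0 τ :=
    ((LipschitzWith.id (α := ℝ)).lipschitzOnWith.absolutelyContinuousOnInterval).const_mul (ν * l)
  have aG : AbsolutelyContinuousOnInterval G 0 τ := (aψ.fun_mul aφ).add (aΘ.sub aid)
  have eG := aG.integral_deriv_eq_sub
  have hGτ : G τ - G 0 = Θ q - Θ 0 - ν * l * τ := by
    simp only [hG, hτq, hψq, φ0, p0]; ring_nf
  have iτ : IntervalIntegrable (fun σ => H σ / √(φ σ)) volume 0 τ := by
    apply iJ.mono_set
    rw [Set.uIcc_of_le hτ.1, Set.uIcc_of_le zero_le_one]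
    exact Set.Icc_subset_Icc_right hτ.2
  have iτ1 : IntervalIntegrable (fun σ => H σ / √(φ σ)) volume τ 1 := by
    apply iJ.mono_set
    rw [Set.uIcc_of_le hτ.2, Set.uIcc_of_le zero_le_one]
    exact Set.Icc_subset_Icc_left hτ.1
  have hle : ∫ x in (0:ℝ)..τ, deriv G x ≤ ∫ x in (0:ℝ)..τ, √l * (H x / √(φ x)) := by
    apply intervalIntegral.integral_mono_ae_restrict hτ.1 aG.intervalIntegrable_deriv (iτ.const_mul _)
    rw [Filter.EventuallyLE, ae_restrict_iff' measurableSet_Icc]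
    have hne : ∀ᵐ x : ℝ, x ≠ 0 := by simp [ae_iff, measure_singleton]
    filter_upwards [deriv_primitive v hm h0 h1, deriv_primitive H Hm H0 H1, hne] with x d1 d2 hx0 hx
    have hxpos : 0 < x := lt_of_le_of_ne hx.1 hx0.symm
    change HasDerivAt φ (v x) x at d1
    change HasDerivAt p (H x) x at d2
    have dP : HasDerivAt (fun x => l * p x) (l * H x) x := d2.const_mul l
    have dG : HasDerivAt G ((-ρ (l * p x) * (l * H x)) * (l * φ x) + ψ (l * p x) * (l * v x)
        + (θ (l * p x) * (l * H x) - ν * l * 1)) x :=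
      (((dψ (l * p x)).comp x dP).mul (d1.const_mul l)).add
        (((dΘ (l * p x)).comp x dP).sub ((hasDerivAt_id' x).const_mul (ν * l)))
    rw [dG.deriv]
    have hPI : l * p x ∈ Set.Icc 0 q := by
      constructor
      · have := mp hx.1
        rw [p0] at this; positivity
      · rw [← hτq]; have := mp hx.2; gcongr
    rcases (φnn x hx.1).eq_or_lt with hz | hpos
    · have hv0 : v x = 0 := by
        have : IsLocalMin φ x := by
          filter_upwards [Ioi_mem_nhds hxpos] with y hy
          rw [← hz]; exact φnn y (le_of_lt hy)
        exact this.hasDerivAt_eq_zero d1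
      have : H x = 0 := by simp [hH, hv0]
      rw [this, hv0]
      simp only [mul_zero, zero_mul, zero_div, zero_add, zero_sub, mul_one]
      have := mul_nonneg hν hl0.le
      linarith
    · have K := key (l * p x) hPI (v x) (l * φ x) (h0 x) (h1 x) (by positivity)
      have K2 := mul_le_mul_of_nonneg_left K hl0.le
      have e : l * (negMulLog (v x) / √(l * φ x)) = √l * (H x / √(φ x)) := by
        rw [Real.sqrt_mul hl0.le]
        have : l = √l * √l := (Real.mul_self_sqrt hl0.le).symm
        have h3 : 0 < √l := by positivity
        have h4 : 0 < √(φ x) := by positivity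
        rw [mul_div_assoc', div_eq_iff (by positivity)]
        nth_rewrite 1 [this]
        simp only [hH]
        field_simp
      rw [e] at K2
      refine le_trans (le_of_eq ?_) K2
      simp only [hH]
      ring
  rw [eG, hGτ, intervalIntegral.integral_const_mul] at hle
  have hsplit := intervalIntegral.integral_add_adjacent_intervals iτ iτ1
  have hn : 0 ≤ ∫ x in τ..1, H x / √(φ x) :=
    intervalIntegral.integral_nonneg hτ.2 fun x _ => div_nonneg (H0 x) (sqrt_nonneg _)
  have h3 : √l * ∫ x in (0:ℝ)..τ, H x / √(φ x) ≤ √l * ∫ x in (0:ℝ)..1, H x / √(φ x) := by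
    gcongr; linarith
  have h4 : ν * l * τ ≤ ν := by
    have : l * τ ≤ 1 := by nlinarith [hτ.1, hτ.2]
    nlinarith
  change _ ≤ √l * ∫ x in (0:ℝ)..1, H x / √(φ x)
  linarith

lemma lift_drag_eq (u : ℝ → ℝ) (hm : Measurable u)
    (hB : ∀ σ ∈ Set.Icc (0:ℝ) 1, 0 ≤ u σ ∧ u σ ≤ 1) :
    ∃ v : ℝ → ℝ, Measurable v ∧ (∀ x, 0 ≤ v x) ∧ (∀ x, v x ≤ 1) ∧
      liftFunctional u = ∫ σ in (0:ℝ)..1, negMulLog (v σ) ∧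
      dragFunctional u = ∫ σ in (0:ℝ)..1, negMulLog (v σ) / √(∫ t in (0:ℝ)..σ, v t) := by
  have huv : ∀ σ ∈ Set.Icc (0:ℝ) 1, max 0 (min 1 (u σ)) = u σ := fun σ h => by
    rw [min_eq_right (hB σ h).2, max_eq_right (hB σ h).1]
  refine ⟨fun x => max 0 (min 1 (u x)), by fun_prop, fun x => le_max_left _ _,
    fun x => max_le zero_le_one (min_le_left _ _), ?_, ?_⟩
  · unfold liftFunctional
    rw [← intervalIntegral.integral_neg]
    apply intervalIntegral.integral_congr
    intro σ hσ
    rw [Set.uIcc_of_le zero_le_one] at hσ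
    simp only [huv σ hσ, negMulLog]
    ring
  · unfold dragFunctional
    rw [← intervalIntegral.integral_neg]
    apply intervalIntegral.integral_congr
    intro σ hσ
    rw [Set.uIcc_of_le zero_le_one] at hσ
    have : ∫ t in (0:ℝ)..σ, max 0 (min 1 (u t)) = ∫ t in (0:ℝ)..σ, u t := by
      apply intervalIntegral.integral_congr
      intro t ht
      rw [Set.uIcc_of_le hσ.1] at ht
      exact huv t ⟨ht.1, ht.2.trans hσ.2⟩
    simp only [huv σ hσ, negMulLog, this]
    ring

/-- Theorem 2 (minimum drag, maximum lift-to-drag ratio): fix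
`b ∈ (√(2/e), √2)` and let `k = K(b)`, `a`, `q(b)`, `J_min(b)` be as in the
paper.  For every `ε ∈ [0,1)` and Brillouin-admissible `u₁, u₂` whose lift
coefficient `C_L = 2{(1-ε) I[u₂] - ε I[u₁]}` equals `2 q(b)`, the drag
coefficient `C_D = (1/(2π))(√(1-ε) J[u₂] + √ε J[u₁])²` satisfies
`C_D ≥ (1/(2π)) J_min(b)²`, and the lift-to-drag ratio `κ = C_L/C_D`
satisfies `κ ≤ 4π q(b)/J_min(b)²`. -/
theorem min_drag_and_max_lift_to_drag
    (b : ℝ) (hb : b ∈ Set.Ioo (Real.sqrt (2 / Real.exp 1)) (Real.sqrt 2))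
    (k a q Jmin : ℝ)
    (hk : k = -((Real.exp 1 - 1) * b * (b ^ 2 * Real.exp 1 - 2)) /
      (2 + (Real.exp 1 - 2) * b ^ 2 * Real.exp 1))
    (ha : a = (b ^ 2 * Real.exp 1 - 2) / ((Real.exp 1 - 1) * b))
    (hq : q = (1 / 2) * (b ^ 2 - k ^ 2 + k * (b - a) - k ^ 2 * Real.log (b / a)))
    (hJmin : Jmin = Real.sqrt 2 * (k * Real.log (b / a) + b + k))
    (ε : ℝ) (hε : ε ∈ Set.Ico (0:ℝ) 1)
    (u₁ u₂ : ℝ → ℝ) (hm₁ : Measurable u₁) (hm₂ : Measurable u₂)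
    (hB₁ : ∀ σ ∈ Set.Icc (0:ℝ) 1, 0 ≤ u₁ σ ∧ u₁ σ ≤ 1)
    (hB₂ : ∀ σ ∈ Set.Icc (0:ℝ) 1, 0 ≤ u₂ σ ∧ u₂ σ ≤ 1)
    (hCL : 2 * ((1 - ε) * liftFunctional u₂ - ε * liftFunctional u₁) = 2 * q) :
    (1 / (2 * Real.pi)) *
        (Real.sqrt (1 - ε) * dragFunctional u₂ +
          Real.sqrt ε * dragFunctional u₁) ^ 2 ≥
      (1 / (2 * Real.pi)) * Jmin ^ 2 ∧
    (2 * ((1 - ε) * liftFunctional u₂ - ε * liftFunctional u₁)) /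
        ((1 / (2 * Real.pi)) *
          (Real.sqrt (1 - ε) * dragFunctional u₂ +
            Real.sqrt ε * dragFunctional u₁) ^ 2) ≤
      4 * Real.pi * q / Jmin ^ 2 := by
  have he : 2 < exp 1 := by have := Real.exp_one_gt_d9; linarith
  set e := exp 1 with hedef
  have he0 : 0 < e := by linarith
  have hb0 : 0 < b := lt_of_le_of_lt (sqrt_nonneg _) hb.1
  have hb1 : 2 < b ^ 2 * e := by
    have := (Real.sqrt_lt' hb0).1 hb.1
    rwa [div_lt_iff₀ he0] at this
  have hb2 : b ^ 2 < 2 := (Real.lt_sqrt hb0.le).1 hb.2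
  have ha0 : 0 < a := by
    rw [ha]; exact div_pos (by linarith) (mul_pos (by linarith) hb0)
  have hrel : a * ((e - 1) * b) = b ^ 2 * e - 2 := by
    rw [ha]; exact div_mul_cancel₀ _ (mul_pos (by linarith) hb0).ne'
  have hab : a < b := by
    rw [ha, div_lt_iff₀ (mul_pos (by linarith) hb0)]; nlinarith
  have hden : 0 < e * b - a := by nlinarith
  have hk' : k * (e * b - a) = -((e - 1) * a * b) := by
    have hd : 0 < 2 + (e - 2) * b ^ 2 * e := by
      have : 0 < (e - 2) * b ^ 2 * e := mul_pos (mul_pos (by linarith) (by positivity)) he0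
      linarith
    have h1 : (e * b - a) * ((e - 1) * b) = 2 + (e - 2) * b ^ 2 * e := by
      rw [sub_mul, hrel]; ring
    have h2 : k * (2 + (e - 2) * b ^ 2 * e) = -((e - 1) * b * (b ^ 2 * e - 2)) := by
      rw [hk]; exact div_mul_cancel₀ _ hd.ne'
    have h3 : (e - 1) * b ≠ 0 := (mul_pos (by linarith) hb0).ne'
    apply mul_right_cancel₀ h3
    rw [mul_assoc, h1, h2, ← hrel]; ring
  have hk0 : k < 0 := by
    have : 0 < (e - 1) * a * b := mul_pos (mul_pos (by linarith) ha0) hb0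
    by_contra hcon
    push Not at hcon
    have := mul_nonneg hcon hden.le
    linarith
  have hba : 0 < b - a := by linarith
  obtain ⟨A, hAdef⟩ : ∃ A, A = (e * b - a) / (b - a) := ⟨_, rfl⟩
  have hA : 0 < A := by rw [hAdef]; positivity
  have hAba : A * (b - a) = e * b - a := by rw [hAdef]; field_simp
  have hAk : A * k * (b - a) = -((e - 1) * a * b) := by
    rw [← hk', ← hAba]; ring
  have h1 : A * (a + k) = a := by
    apply mul_right_cancel₀ hba.ne'
    linear_combination a * hAba + hAk
  have h2 : A * (b + k) = e * b := by
    apply mul_right_cancel₀ hba.ne'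
    linear_combination b * hAba + hAk
  have hak : 0 < a + k := by
    by_contra hcon
    push Not at hcon
    have := mul_nonpos_of_nonneg_of_nonpos hA.le hcon
    linarith
  have h3 : A * (b ^ 2 + 2 * k * b - k * a) = 2 := by
    apply mul_right_cancel₀ hba.ne'
    linear_combination b ^ 2 * hAba + (2 * b - a) * hAk - (b - a) * hrel
  obtain ⟨S, hS⟩ : ∃ S, S = k * Real.log (b / a) + b + k := ⟨_, rfl⟩
  obtain ⟨ν, hν⟩ : ∃ ν, ν = -√2 / (A * k) := ⟨_, rfl⟩
  have hr : 0 < √2 := by positivity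
  have hr2 : √2 ^ 2 = 2 := Real.sq_sqrt (by norm_num)
  have hν0 : 0 ≤ ν := by
    rw [hν]; exact (div_pos_of_neg_of_neg (by linarith) (mul_neg_of_pos_of_neg hA hk0)).le
  obtain ⟨hq0, hS0, ψ, Θ, ρ, θ, C, lψ, lΘ, dψ, dΘ, hψq, hΘ, key⟩ :=
    calibration a b k A ha0 hab hk0 hA hak h1 h2 q S ν hν hq hS
  have hval : Θ q - Θ 0 - ν = Jmin := by
    have hAS : 2 * (A * q - 1) = -(A * k * S) := by
      rw [hq, hS]; linear_combination h3
    have hAk0 : A * k ≠ 0 := (mul_neg_of_pos_of_neg hA hk0).ne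
    have hνk : ν * (A * k) = -√2 := by rw [hν]; exact div_mul_cancel₀ _ hAk0
    have e1 : 2 * ν * (A * q - 1) = √2 * S := by
      linear_combination ν * hAS - S * hνk
    have e2 : S / √2 = √2 * S / 2 := by
      field_simp; rw [hr2]
    rw [hΘ, e2, hJmin, ← hS]
    linear_combination e1 / 2
  have hJ0 : 0 < Jmin := by rw [hJmin, ← hS]; positivity
  obtain ⟨v₁, m₁, z₁, o₁, L₁, D₁⟩ := lift_drag_eq u₁ hm₁ hB₁
  obtain ⟨v₂, m₂, z₂, o₂, L₂, D₂⟩ := lift_drag_eq u₂ hm₂ hB₂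
  have hL1 : 0 ≤ liftFunctional u₁ := by
    rw [L₁]
    exact intervalIntegral.integral_nonneg zero_le_one fun x _ => negMulLog_nonneg (z₁ x) (o₁ x)
  have hD1 : 0 ≤ dragFunctional u₁ := by
    rw [D₁]
    exact intervalIntegral.integral_nonneg zero_le_one fun x _ =>
      div_nonneg (negMulLog_nonneg (z₁ x) (o₁ x)) (sqrt_nonneg _)
  have hI : q ≤ (1 - ε) * ∫ σ in (0:ℝ)..1, negMulLog (v₂ σ) := by
    rw [← L₂]
    have := mul_nonneg hε.1 hL1
    linarith
  have hT := time_bound v₂ m₂ z₂ o₂ (1 - ε) q ν (by linarith [hε.2]) (by linarith [hε.1]) hq0 hν0 hI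
    ψ Θ ρ θ C lψ lΘ dψ dΘ hψq key
  rw [hval, ← D₂] at hT
  have hsum : Jmin ≤ √(1 - ε) * dragFunctional u₂ + √ε * dragFunctional u₁ := by
    have := mul_nonneg (sqrt_nonneg ε) hD1
    linarith
  have hpi := Real.pi_pos
  have first : (1 / (2 * π)) * Jmin ^ 2 ≤
      (1 / (2 * π)) * (√(1 - ε) * dragFunctional u₂ + √ε * dragFunctional u₁) ^ 2 := by
    gcongr
  refine ⟨first, ?_⟩
  rw [hCL]
  calc _ ≤ 2 * q / ((1 / (2 * π)) * Jmin ^ 2) := by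
        apply div_le_div_of_nonneg_left (by positivity) (by positivity) first
    _ = 4 * π * q / Jmin ^ 2 := by field_simp; ring
end
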